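/- arXiv:math/0002056 — 3 statements merged into one kernel-verified Lean document; each statement's English description precedes it below -/
import Mathlib

section
/- For n ≥ 2, let A_n denote the number of compositions of the ladder graph L_n in which the vertices (n,1) and (n,2) lie in different blocks, and let B_n denote the number of compositions of L_n in which (n,1) and (n,2) lie in the same block. Then A_n = 4·A_{n−1} + 3·B_{n−1} and B_n = 3·A_{n−1} + 2·B_{n−1}. -/
/-- The ladder graph `L_n`: the Cartesian (box) product of a path on `2` vertices with
a path on `n` vertices.  Its vertices are pairs `(j, i)` with `j ∈ Fin 2` a row index
and `i ∈ Fin n` a column index. -/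
def ladderGraph (n : ℕ) : SimpleGraph (Fin 2 × Fin n) :=
  (SimpleGraph.pathGraph 2).boxProd (SimpleGraph.pathGraph n)

/-- `ladderSame n` is the number of compositions of the ladder graph `L_n` in which the
two vertices of the last column (column `n - 1`) lie in the same block. -/
noncomputable def ladderSame (n : ℕ) : ℕ :=
  Nat.card {P : Finpartition (Finset.univ : Finset (Fin 2 × Fin n)) //
    (∀ b ∈ P.parts, ((ladderGraph n).induce (b : Set (Fin 2 × Fin n))).Connected) ∧
    ∃ b ∈ P.parts, ∀ p : Fin 2 × Fin n, (p.2 : ℕ) = n - 1 → p ∈ b}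

/-- `ladderDiff n` is the number of compositions of the ladder graph `L_n` in which the
two vertices of the last column (column `n - 1`) lie in different blocks. -/
noncomputable def ladderDiff (n : ℕ) : ℕ :=
  Nat.card {P : Finpartition (Finset.univ : Finset (Fin 2 × Fin n)) //
    (∀ b ∈ P.parts, ((ladderGraph n).induce (b : Set (Fin 2 × Fin n))).Connected) ∧
    ¬ ∃ b ∈ P.parts, ∀ p : Fin 2 × Fin n, (p.2 : ℕ) = n - 1 → p ∈ b}

open Relation

namespace SimpleGraph

variable {V W : Type*}

/-- A setoid is a composition of `G` when any two related vertices are joined by a path of edges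
inside their class. -/
def IsComposition (G : SimpleGraph V) (r : Setoid V) : Prop :=
  r ≤ EqvGen.setoid fun x y => G.Adj x y ∧ r x y

/-- To prove that a composition `r` refines a setoid `s`, it suffices to compare them on edges. -/
theorem IsComposition.le {G : SimpleGraph V} {r s : Setoid V} (h : G.IsComposition r)
    (hs : ∀ x y, G.Adj x y → r x y → s x y) : r ≤ s :=
  h.trans (Setoid.eqvGen_le fun x y hxy => hs x y hxy.1 hxy.2)

theorem IsComposition.comap_iso {G : SimpleGraph V} {H : SimpleGraph W} (e : G ≃g H)
    {r : Setoid W} (h : H.IsComposition r) : G.IsComposition (r.comap e) := by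
  have key : r ≤ (EqvGen.setoid fun x y => G.Adj x y ∧ r.comap e x y).comap e.symm := by
    refine h.le fun x y hxy hr => EqvGen.rel _ _ ⟨e.symm.map_adj_iff.2 hxy, ?_⟩
    simpa [Setoid.comap_rel] using hr
  intro x y hxy
  simpa [Setoid.comap_rel] using key hxy

theorem ncard_isComposition_congr {G : SimpleGraph V} {H : SimpleGraph W} (e : G ≃g H)
    (q : Prop → Prop) (u v : V) :
    {r | G.IsComposition r ∧ q (r u v)}.ncard =
      {r | H.IsComposition r ∧ q (r (e u) (e v))}.ncard := by
  have hl (r : Setoid V) : (r.comap e.symm).comap e = r := by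
    ext x y; simp [Setoid.comap_rel]
  have hr (r : Setoid W) : (r.comap e).comap e.symm = r := by
    ext x y; simp [Setoid.comap_rel]
  refine Set.ncard_congr (fun r _ => r.comap e.symm) ?_ ?_ ?_
  · rintro r ⟨h, hq⟩
    exact ⟨h.comap_iso e.symm, by simpa [Setoid.comap_rel] using hq⟩
  · intro r s _ _ h
    rw [← hl r, ← hl s, h]
  · rintro r ⟨h, hq⟩
    exact ⟨r.comap e, ⟨h.comap_iso e, hq⟩, hr r⟩

/-- The graph obtained from `G` by adding two adjacent vertices, the vertex indexed by `c` being
joined to `d c`. -/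
def attachEdge (G : SimpleGraph V) (d : Bool → V) : SimpleGraph (V ⊕ Bool) where
  Adj
    | .inl x, .inl y => G.Adj x y
    | .inl x, .inr c => x = d c
    | .inr c, .inl x => x = d c
    | .inr c, .inr c' => c ≠ c'
  symm := ⟨by
    rintro (x | c) (y | c') h
    exacts [G.adj_symm h, h, h, Ne.symm h]⟩
  loopless := ⟨by
    rintro (x | c) h
    exacts [G.loopless.irrefl _ h, h rfl]⟩

variable {G : SimpleGraph V} {d : Bool → V}

@[simp] theorem attachEdge_adj_inl_inl {x y : V} :
    (G.attachEdge d).Adj (.inl x) (.inl y) ↔ G.Adj x y := Iff.rfl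

@[simp] theorem attachEdge_adj_inl_inr {x : V} {c : Bool} :
    (G.attachEdge d).Adj (.inl x) (.inr c) ↔ x = d c := Iff.rfl

@[simp] theorem attachEdge_adj_inr_inl {x : V} {c : Bool} :
    (G.attachEdge d).Adj (.inr c) (.inl x) ↔ x = d c := Iff.rfl

@[simp] theorem attachEdge_adj_inr_inr {c c' : Bool} :
    (G.attachEdge d).Adj (.inr c) (.inr c') ↔ c ≠ c' := Iff.rfl

/-- In the 4-cycle through `d false`, `d true` and the two new vertices, the number of edges lying
inside a block is not three. -/
def SquareCompatible (t s : Prop) (p : Bool → Bool) : Prop :=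
  (t → s → p false = p true) ∧ (p false = true → p true = true → (t ↔ s))

instance (t s : Prop) [Decidable t] [Decidable s] (p : Bool → Bool) :
    Decidable (SquareCompatible t s p) :=
  inferInstanceAs (Decidable (_ ∧ _))

open Classical in
/-- The class, in the extension of `r`, of a vertex of `G.attachEdge d`. -/
noncomputable def extendClass (r : Setoid V) (d : Bool → V) (s : Prop) (p : Bool → Bool) :
    V ⊕ Bool → Quotient r ⊕ Bool
  | .inl x => .inl ⟦x⟧
  | .inr c =>
    if p c then .inl ⟦d c⟧ else if s then if p !c then .inl ⟦d !c⟧ else .inr true else .inr c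

/-- The partition of the vertices of `G.attachEdge d` that restricts to `r`, in which the two new
vertices are related iff `s`, and are related to their neighbours according to `p`. -/
noncomputable def extend (r : Setoid V) (d : Bool → V) (s : Prop) (p : Bool → Bool) :
    Setoid (V ⊕ Bool) :=
  Setoid.ker (extendClass r d s p)

theorem extend_iff {r : Setoid V} {s : Prop} {p : Bool → Bool} {x y : V ⊕ Bool} :
    extend r d s p x y ↔ extendClass r d s p x = extendClass r d s p y := Iff.rfl

theorem extend_inl_inl {r : Setoid V} {s : Prop} {p : Bool → Bool} {x y : V} :
    extend r d s p (.inl x) (.inl y) ↔ r x y := by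
  simp [extend_iff, extendClass, Quotient.eq]

theorem extend_inr_inl {r : Setoid V} {s : Prop} {p : Bool → Bool} {c : Bool} {x : V} :
    extend r d s p (.inr c) (.inl x) ↔
      (p c = true ∧ r (d c) x) ∨ (p c = false ∧ s ∧ p (!c) = true ∧ r (d !c) x) := by
  by_cases h1 : p c = true <;> by_cases h2 : s <;> by_cases h3 : p (!c) = true <;>
    simp [extend_iff, extendClass, Quotient.eq, h1, h2, h3]

theorem extend_inr_inr {r : Setoid V} {s : Prop} {p : Bool → Bool}
    (h : SquareCompatible (r (d false) (d true)) s p) :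
    extend r d s p (.inr false) (.inr true) ↔ s := by
  unfold SquareCompatible at h
  by_cases h1 : p false = true <;> by_cases h2 : s <;> by_cases h3 : p true = true <;>
    simp_all [extend_iff, extendClass, Quotient.eq]

theorem isComposition_extend {r : Setoid V} {s : Prop} {p : Bool → Bool}
    (hr : G.IsComposition r) (h : SquareCompatible (r (d false) (d true)) s p) :
    (G.attachEdge d).IsComposition (extend r d s p) := by
  set R := extend r d s p
  set E := EqvGen.setoid fun x y => (G.attachEdge d).Adj x y ∧ R x y
  have hrel {x y} (h1 : (G.attachEdge d).Adj x y) (h2 : R x y) : E x y := EqvGen.rel _ _ ⟨h1, h2⟩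
  have hll : r ≤ E.comap Sum.inl :=
    hr.le fun x y hxy h => hrel hxy (extend_inl_inl.2 h)
  have hss (hs : s) (c : Bool) : E (.inr c) (.inr !c) := by
    have : E (.inr false) (.inr true) := hrel (by simp) ((extend_inr_inr h).2 hs)
    cases c
    · exact this
    · exact E.symm' this
  have hp (c : Bool) (hc : p c = true) : E (.inr c) (.inl (d c)) :=
    hrel rfl (extend_inr_inl.2 (.inl ⟨hc, r.refl' _⟩))
  have hrl (c : Bool) (x : V) (hx : R (.inr c) (.inl x)) : E (.inr c) (.inl x) := by
    rcases extend_inr_inl.1 hx with ⟨h1, h2⟩ | ⟨-, h2, h3, h4⟩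
    · exact E.trans' (hp c h1) (hll h2)
    · exact E.trans' (hss h2 c) (E.trans' (hp _ h3) (hll h4))
  rintro (x | c) (y | c') hxy
  · exact hll (extend_inl_inl.1 hxy)
  · exact E.symm' (hrl _ _ (R.symm' hxy))
  · exact hrl _ _ hxy
  · have hft (h' : R (.inr false) (.inr true)) := (extend_inr_inr h).1 h'
    cases c <;> cases c'
    · exact E.refl' _
    · exact hss (hft hxy) false
    · exact hss (hft (R.symm' hxy)) true
    · exact E.refl' _

/-- Restricting a composition of `G.attachEdge d` to `G` gives a composition: a detour through the
new vertices can be replaced by the edge between their neighbours. -/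
theorem IsComposition.restrict (hd : G.Adj (d false) (d true)) {R : Setoid (V ⊕ Bool)}
    (hR : (G.attachEdge d).IsComposition R) : G.IsComposition (R.comap Sum.inl) := by
  classical
  set E := EqvGen.setoid fun x y => G.Adj x y ∧ R.comap Sum.inl x y
  let p (c : Bool) : Prop := R (.inr c) (.inl (d c))
  let f : V ⊕ Bool → V := Sum.elim id fun c => if p c then d c else if p !c then d !c else d true
  have hE (h : R (.inl (d false)) (.inl (d true))) : E (d false) (d true) :=
    EqvGen.rel _ _ ⟨hd, h⟩
  have hf (h : R (.inr false) (.inr true)) : E (f (.inr false)) (f (.inr true)) := by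
    by_cases h0 : p false <;> by_cases h1 : p true <;> simp only [f, Sum.elim_inr, h0, h1,
      Bool.not_false, Bool.not_true, if_true, if_false]
    · exact hE (R.trans' (R.symm' h0) (R.trans' h h1))
    all_goals exact E.refl' _
  have hpc (c : Bool) (h : p c) : f (.inr c) = d c := if_pos h
  have key : R ≤ E.comap f := by
    refine hR.le ?_
    rintro (x | c) (y | c') hxy h
    · exact EqvGen.rel _ _ ⟨hxy, h⟩
    · obtain rfl : x = d c' := hxy
      simp only [Setoid.comap_rel, hpc c' (R.symm' h)]
      exact E.refl' _
    · obtain rfl : y = d c := hxy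
      simp only [Setoid.comap_rel, hpc c h]
      exact E.refl' _
    · cases c <;> cases c'
      · exact E.refl' _
      · exact hf h
      · exact E.symm' (hf (R.symm' h))
      · exact E.refl' _
  exact fun x y hxy => key hxy

/-- A block of a composition of `G.attachEdge d` that contains a new vertex and a vertex of `G`
uses one of the two edges between them. -/
theorem IsComposition.attach_cases {R : Setoid (V ⊕ Bool)}
    (hR : (G.attachEdge d).IsComposition R) {c : Bool} {x : V} (h : R (.inr c) (.inl x)) :
    R (.inr c) (.inl (d c)) ∨ (R (.inr c) (.inr !c) ∧ R (.inr !c) (.inl (d !c))) := by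
  by_contra! hn
  obtain ⟨h1, h2⟩ := hn
  by_cases hs : R (.inr c) (.inr !c)
  · have key : R ≤ Setoid.ker Sum.isRight := by
      refine hR.le ?_
      have hno (c' : Bool) : ¬ R (.inr c') (.inl (d c')) := by
        rcases Bool.eq_or_eq_not c' c with rfl | rfl
        exacts [h1, h2 hs]
      rintro (y | a) (z | b) hyz h
      · rfl
      · obtain rfl : y = d b := hyz
        exact (hno b (R.symm' h)).elim
      · obtain rfl : z = d a := hyz
        exact (hno a h).elim
      · rfl
    simpa [Setoid.ker_def] using key h
  · have key : R ≤ Setoid.ker fun y => y = .inr c := by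
      refine hR.le ?_
      have hno (y) (hy : (G.attachEdge d).Adj (.inr c) y) : ¬ R (.inr c) y := by
        rcases y with y | b
        · obtain rfl : y = d c := hy
          exact h1
        · obtain rfl : b = !c := Bool.eq_not_of_ne (Ne.symm hy)
          exact hs
      intro y z hyz h
      rw [Setoid.ker_def, eq_iff_iff]
      constructor
      · rintro rfl
        exact (hno _ hyz h).elim
      · rintro rfl
        exact (hno _ hyz.symm (R.symm' h)).elim
    simpa [Setoid.ker_def] using key h

theorem squareCompatible_of_setoid {R : Setoid (V ⊕ Bool)} {p : Bool → Bool}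
    (hp : ∀ c, p c = true ↔ R (.inr c) (.inl (d c))) :
    SquareCompatible (R (.inl (d false)) (.inl (d true))) (R (.inr false) (.inr true)) p := by
  refine ⟨fun ht hs => Bool.eq_iff_iff.2 ?_, fun h0 h1 => ?_⟩
  · rw [hp, hp]
    exact ⟨fun h => R.trans' (R.symm' hs) (R.trans' h ht),
      fun h => R.trans' hs (R.trans' h (R.symm' ht))⟩
  · rw [hp] at h0 h1
    exact ⟨fun h => R.trans' h0 (R.trans' h (R.symm' h1)),
      fun h => R.trans' (R.symm' h0) (R.trans' h h1)⟩

theorem IsComposition.eq_extend {R : Setoid (V ⊕ Bool)} (hR : (G.attachEdge d).IsComposition R)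
    {p : Bool → Bool} (hp : ∀ c, p c = true ↔ R (.inr c) (.inl (d c))) :
    extend (R.comap Sum.inl) d (R (.inr false) (.inr true)) p = R := by
  have hp' (c) : p c = false ↔ ¬ R (.inr c) (.inl (d c)) := by rw [← hp, Bool.not_eq_true]
  have hs (c : Bool) : R (.inr false) (.inr true) ↔ R (.inr c) (.inr !c) := by
    cases c
    exacts [Iff.rfl, R.comm']
  have hrl (c : Bool) (x : V) :
      extend (R.comap Sum.inl) d (R (.inr false) (.inr true)) p (.inr c) (.inl x) ↔
        R (.inr c) (.inl x) := by
    rw [extend_inr_inl, hp, hp', hp, hs c]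
    constructor
    · rintro (⟨h1, h2⟩ | ⟨-, h2, h3, h4⟩)
      exacts [R.trans' h1 h2, R.trans' h2 (R.trans' h3 h4)]
    · intro h
      by_cases h1 : R (.inr c) (.inl (d c))
      · exact .inl ⟨h1, R.trans' (R.symm' h1) h⟩
      · obtain ⟨h2, h3⟩ := (hR.attach_cases h).resolve_left h1
        exact .inr ⟨h1, h2, h3, R.trans' (R.symm' h3) (R.trans' (R.symm' h2) h)⟩
  have hft := extend_inr_inr (r := R.comap Sum.inl) (squareCompatible_of_setoid hp)
  ext (x | c) (y | c')
  · exact extend_inl_inl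
  · rw [Setoid.comm', hrl, Setoid.comm']
  · exact hrl c y
  · cases c <;> cases c'
    · exact iff_of_true (Setoid.refl' _ _) (Setoid.refl' _ _)
    · exact hft
    · rw [Setoid.comm', hft, Setoid.comm']
    · exact iff_of_true (Setoid.refl' _ _) (Setoid.refl' _ _)

theorem extend_inr_inl_self {r : Setoid V} {s : Prop} {p : Bool → Bool}
    (h : SquareCompatible (r (d false) (d true)) s p) (c : Bool) :
    extend r d s p (.inr c) (.inl (d c)) ↔ p c = true := by
  rw [extend_inr_inl]
  unfold SquareCompatible at h
  have := r.comm' (x := d false) (y := d true)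
  have := r.refl' (d c)
  cases c <;> grind

/-- Compositions of `G.attachEdge d` correspond to compositions of `G` together with compatible
data on the new edges. -/
theorem ncard_isComposition_attachEdge (hd : G.Adj (d false) (d true)) (s : Prop) :
    {R | (G.attachEdge d).IsComposition R ∧ (R (.inr false) (.inr true) ↔ s)}.ncard =
      {x : Setoid V × (Bool → Bool) | G.IsComposition x.1 ∧
        SquareCompatible (x.1 (d false) (d true)) s x.2}.ncard := by
  classical
  symm
  refine Set.ncard_congr (fun x _ => extend x.1 d s x.2) ?_ ?_ ?_
  · rintro ⟨r, p⟩ ⟨hr, h⟩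
    exact ⟨isComposition_extend hr h, extend_inr_inr h⟩
  · rintro ⟨r, p⟩ ⟨r', p'⟩ ⟨-, h⟩ ⟨-, h'⟩ heq
    simp only at heq h h'
    refine Prod.ext (Setoid.ext fun x y => ?_) (funext fun c => Bool.eq_iff_iff.2 ?_)
    · rw [← extend_inl_inl (d := d) (s := s) (p := p), heq, extend_inl_inl]
    · rw [← extend_inr_inl_self h, heq, extend_inr_inl_self h']
  · rintro R ⟨hR, hs⟩
    obtain rfl : R (.inr false) (.inr true) = s := propext hs
    have hp (c : Bool) : decide (R (.inr c) (.inl (d c))) = true ↔ R (.inr c) (.inl (d c)) :=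
      decide_eq_true_iff
    exact ⟨(R.comap Sum.inl, fun c => decide (R (.inr c) (.inl (d c)))),
      ⟨hR.restrict hd, squareCompatible_of_setoid hp⟩, hR.eq_extend hp⟩

theorem ncard_isComposition_and_compatible [Finite V] (u v : V) (s : Prop) :
    {x : Setoid V × (Bool → Bool) | G.IsComposition x.1 ∧
        SquareCompatible (x.1 u v) s x.2}.ncard =
      {r | G.IsComposition r ∧ ¬ r u v}.ncard * {p | SquareCompatible False s p}.ncard +
      {r | G.IsComposition r ∧ r u v}.ncard * {p | SquareCompatible True s p}.ncard := by
  have : Finite (Setoid V) := Finite.of_injective (fun r : Setoid V => r.r) fun r s h =>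
    Setoid.ext fun x y => iff_of_eq (congrFun₂ h x y)
  rw [← Set.ncard_prod, ← Set.ncard_prod, ← Set.ncard_union_eq]
  · congr 1
    ext ⟨r, p⟩
    by_cases h : r u v <;> simp [h]
  · rw [Set.disjoint_left]
    rintro ⟨r, p⟩ ⟨⟨-, h⟩, -⟩ ⟨⟨-, h'⟩, -⟩
    exact h h'

theorem ncard_attachEdge_ne [Finite V] (hd : G.Adj (d false) (d true)) :
    {R | (G.attachEdge d).IsComposition R ∧ ¬ R (.inr false) (.inr true)}.ncard =
      4 * {r | G.IsComposition r ∧ ¬ r (d false) (d true)}.ncard +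
      3 * {r | G.IsComposition r ∧ r (d false) (d true)}.ncard := by
  have h := ncard_isComposition_attachEdge hd False
  rw [ncard_isComposition_and_compatible] at h
  have h0 : {p | SquareCompatible False False p}.ncard = 4 := by
    rw [Set.ncard_eq_toFinset_card']; decide
  have h1 : {p | SquareCompatible True False p}.ncard = 3 := by
    rw [Set.ncard_eq_toFinset_card']; decide
  simp only [iff_false] at h
  rw [h, h0, h1, mul_comm, mul_comm 3]

theorem ncard_attachEdge_eq [Finite V] (hd : G.Adj (d false) (d true)) :
    {R | (G.attachEdge d).IsComposition R ∧ R (.inr false) (.inr true)}.ncard =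
      3 * {r | G.IsComposition r ∧ ¬ r (d false) (d true)}.ncard +
      2 * {r | G.IsComposition r ∧ r (d false) (d true)}.ncard := by
  have h := ncard_isComposition_attachEdge hd True
  rw [ncard_isComposition_and_compatible] at h
  have h0 : {p | SquareCompatible False True p}.ncard = 3 := by
    rw [Set.ncard_eq_toFinset_card']; decide
  have h1 : {p | SquareCompatible True True p}.ncard = 2 := by
    rw [Set.ncard_eq_toFinset_card']; decide
  simp only [iff_true] at h
  rw [h, h0, h1, mul_comm, mul_comm 2]

variable [Fintype V] [DecidableEq V]

theorem forall_connected_induce_iff (P : Finpartition (Finset.univ : Finset V)) :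
    (∀ b ∈ P.parts, (G.induce (b : Set V)).Connected) ↔ G.IsComposition (Setoid.ker P.part) := by
  constructor
  · intro h x y hxy
    have hb : P.part x ∈ P.parts := P.part_mem.2 (Finset.mem_univ x)
    have hx : x ∈ P.part x := P.mem_part (Finset.mem_univ x)
    have hy : y ∈ P.part x := by
      rw [Setoid.ker_def.1 hxy]; exact P.mem_part (Finset.mem_univ y)
    have hreach := (h _ hb).preconnected ⟨x, hx⟩ ⟨y, hy⟩
    rw [reachable_iff_reflTransGen] at hreach
    exact EqvGen.reflTransGen_le_eqvGen _ _ _ (hreach.lift Subtype.val fun a b hab =>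
      ⟨hab, (P.part_eq_of_mem hb a.2).trans (P.part_eq_of_mem hb b.2).symm⟩)
  · intro h b hb
    have key (x y : V) (hxy : EqvGen (fun x y => G.Adj x y ∧ Setoid.ker P.part x y) x y) :
        (x ∈ b ↔ y ∈ b) ∧ ∀ (hx : x ∈ b) (hy : y ∈ b),
          (G.induce (b : Set V)).Reachable ⟨x, hx⟩ ⟨y, hy⟩ := by
      induction hxy with
      | rel x y hxy =>
        refine ⟨?_, fun hx hy => Adj.reachable hxy.1⟩
        rw [← P.part_eq_iff_mem hb, Setoid.ker_def.1 hxy.2, P.part_eq_iff_mem hb]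
      | refl x => exact ⟨Iff.rfl, fun _ _ => .rfl⟩
      | symm x y _ ih => exact ⟨ih.1.symm, fun hx hy => (ih.2 hy hx).symm⟩
      | trans x y z _ _ ih₁ ih₂ =>
        exact ⟨ih₁.1.trans ih₂.1, fun hx hz =>
          (ih₁.2 hx (ih₁.1.1 hx)).trans (ih₂.2 (ih₁.1.1 hx) hz)⟩
    obtain ⟨x, hx⟩ := P.nonempty_of_mem_parts hb
    refine (connected_iff _).2 ⟨?_, ⟨⟨x, hx⟩⟩⟩
    rintro ⟨y, hy⟩ ⟨z, hz⟩
    exact (key y z (h ((P.part_eq_of_mem hb hy).trans (P.part_eq_of_mem hb hz).symm))).2 hy hz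

theorem bijective_ker_part :
    Function.Bijective fun P : Finpartition (Finset.univ : Finset V) => Setoid.ker P.part := by
  classical
  constructor
  · intro P Q h
    have hPQ (x : V) : P.part x = Q.part x := by
      ext y
      rw [P.mem_part_iff_part_eq_part (Finset.mem_univ _) (Finset.mem_univ _),
        Q.mem_part_iff_part_eq_part (Finset.mem_univ _) (Finset.mem_univ _)]
      exact Setoid.ext_iff.1 h y x
    have hle (P Q : Finpartition (Finset.univ : Finset V)) (hPQ : ∀ x, P.part x = Q.part x) :
        P.parts ⊆ Q.parts := by
      intro b hb
      obtain ⟨x, hx⟩ := P.nonempty_of_mem_parts hb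
      rw [← P.part_eq_of_mem hb hx, hPQ]
      exact Q.part_mem.2 (Finset.mem_univ x)
    exact Finpartition.ext ((hle P Q hPQ).antisymm (hle Q P fun x => (hPQ x).symm))
  · intro r
    refine ⟨Finpartition.ofSetoid r, Setoid.ext fun x y => ?_⟩
    rw [Setoid.ker_def, ← Finpartition.mem_part_iff_part_eq_part _ (Finset.mem_univ _)
      (Finset.mem_univ _), Finpartition.mem_part_ofSetoid_iff_rel, Setoid.comm']

/-- Counting compositions as finpartitions is the same as counting them as setoids. -/
theorem card_finpartition_eq_ncard (q : Finpartition (Finset.univ : Finset V) → Prop)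
    (q' : Setoid V → Prop) (hq : ∀ P, q P ↔ q' (Setoid.ker P.part)) :
    Nat.card {P : Finpartition (Finset.univ : Finset V) //
      (∀ b ∈ P.parts, (G.induce (b : Set V)).Connected) ∧ q P} =
      {r | G.IsComposition r ∧ q' r}.ncard := by
  rw [← Nat.card_coe_set_eq]
  refine Nat.card_congr ((Equiv.ofBijective _ bijective_ker_part).subtypeEquiv fun P => ?_)
  rw [forall_connected_induce_iff, hq]
  rfl

end SimpleGraph

open SimpleGraph

theorem exists_part_last_column_iff {m : ℕ}
    (P : Finpartition (Finset.univ : Finset (Fin 2 × Fin (m + 1)))) :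
    (∃ b ∈ P.parts, ∀ p : Fin 2 × Fin (m + 1), (p.2 : ℕ) = m + 1 - 1 → p ∈ b) ↔
      Setoid.ker P.part (0, Fin.last m) (1, Fin.last m) := by
  rw [Setoid.ker_def]
  constructor
  · rintro ⟨b, hb, h⟩
    rw [P.part_eq_of_mem hb (h (0, Fin.last m) rfl), P.part_eq_of_mem hb (h (1, Fin.last m) rfl)]
  · intro h
    refine ⟨_, P.part_mem.2 (Finset.mem_univ (0, Fin.last m)), ?_⟩
    rintro ⟨j, i⟩ hi
    obtain rfl : i = Fin.last m := Fin.ext hi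
    obtain rfl | rfl : j = 0 ∨ j = 1 := by omega
    · exact P.mem_part (Finset.mem_univ _)
    · rw [h]
      exact P.mem_part (Finset.mem_univ _)

theorem ladderSame_succ (m : ℕ) : ladderSame (m + 1) =
    {r | (ladderGraph (m + 1)).IsComposition r ∧ r (0, Fin.last m) (1, Fin.last m)}.ncard :=
  card_finpartition_eq_ncard _ _ exists_part_last_column_iff

theorem ladderDiff_succ (m : ℕ) : ladderDiff (m + 1) =
    {r | (ladderGraph (m + 1)).IsComposition r ∧ ¬ r (0, Fin.last m) (1, Fin.last m)}.ncard :=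
  card_finpartition_eq_ncard _ (fun r => ¬ r (0, Fin.last m) (1, Fin.last m))
    fun P => not_congr (exists_part_last_column_iff P)

/-- The vertex of the last column of `L_{m+1}` in the row indexed by a Boolean. -/
def ladderEnd (m : ℕ) (c : Bool) : Fin 2 × Fin (m + 1) := (if c then 1 else 0, Fin.last m)

/-- The inclusion of `L_{m+1}` with an edge attached to its last column into `L_{m+2}`. -/
def ladderMap (m : ℕ) : Fin 2 × Fin (m + 1) ⊕ Bool → Fin 2 × Fin (m + 2) :=
  Sum.elim (Prod.map id Fin.castSucc) (ladderEnd (m + 1))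

theorem bijective_ladderMap (m : ℕ) : Function.Bijective (ladderMap m) := by
  constructor
  · rintro (⟨j, i⟩ | c) (⟨j', i'⟩ | c') h
    · simpa [ladderMap] using h
    · simp [ladderMap, ladderEnd, Fin.castSucc_ne_last] at h
    · simp [ladderMap, ladderEnd, (Fin.castSucc_ne_last _).symm] at h
    · revert h
      cases c <;> cases c' <;> simp [ladderMap, ladderEnd]
  · rintro ⟨j, i⟩
    induction i using Fin.lastCases with
    | last =>
      obtain rfl | rfl : j = 0 ∨ j = 1 := by omega
      exacts [⟨.inr false, rfl⟩, ⟨.inr true, rfl⟩]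
    | cast i => exact ⟨.inl (j, i), rfl⟩

theorem ladderMap_adj_iff (m : ℕ) (x y : Fin 2 × Fin (m + 1) ⊕ Bool) :
    (ladderGraph (m + 2)).Adj (ladderMap m x) (ladderMap m y) ↔
      ((ladderGraph (m + 1)).attachEdge (ladderEnd m)).Adj x y := by
  rcases x with ⟨j, i⟩ | c <;> rcases y with ⟨j', i'⟩ | c'
  · simp [ladderMap, ladderGraph, boxProd_adj, pathGraph_adj]
  · cases c' <;>
      simp [ladderMap, ladderGraph, boxProd_adj, pathGraph_adj, ladderEnd] <;>
      grind
  · cases c <;>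
      simp [ladderMap, ladderGraph, boxProd_adj, pathGraph_adj, ladderEnd] <;>
      grind
  · cases c <;> cases c' <;>
      simp [ladderMap, ladderGraph, boxProd_adj, pathGraph_adj, ladderEnd]

/-- `L_{m+2}` is obtained from `L_{m+1}` by attaching an edge to its last column. -/
noncomputable def ladderIso (m : ℕ) :
    (ladderGraph (m + 1)).attachEdge (ladderEnd m) ≃g ladderGraph (m + 2) where
  toEquiv := Equiv.ofBijective _ (bijective_ladderMap m)
  map_rel_iff' := ladderMap_adj_iff m _ _

theorem ladderEnd_adj (m : ℕ) :
    (ladderGraph (m + 1)).Adj (ladderEnd m false) (ladderEnd m true) := by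
  simp [ladderGraph, boxProd_adj, pathGraph_adj, ladderEnd]

/-- For `n ≥ 2`, with `A_n` the number of compositions of `L_n` in which the two
last-column vertices lie in different blocks and `B_n` the number in which they lie in
the same block: `A_n = 4·A_{n−1} + 3·B_{n−1}` and `B_n = 3·A_{n−1} + 2·B_{n−1}`. -/
theorem ladder_recurrences (n : ℕ) (hn : 2 ≤ n) :
    ladderDiff n = 4 * ladderDiff (n - 1) + 3 * ladderSame (n - 1) ∧
    ladderSame n = 3 * ladderDiff (n - 1) + 2 * ladderSame (n - 1) := by
  obtain ⟨m, rfl⟩ := Nat.exists_eq_add_of_le' hn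
  rw [show m + 2 - 1 = m + 1 from rfl, ladderDiff_succ, ladderSame_succ, ladderDiff_succ,
    ladderSame_succ]
  exact ⟨(ncard_isComposition_congr (ladderIso m) Not (.inr false) (.inr true)).symm.trans
      (ncard_attachEdge_ne (ladderEnd_adj m)),
    (ncard_isComposition_congr (ladderIso m) id (.inr false) (.inr true)).symm.trans
      (ncard_attachEdge_eq (ladderEnd_adj m))⟩
end

section
/- For all integers m ≥ 1 and n ≥ 0, the number of compositions of the complete bipartite graph K_{m,n} satisfies C(K_{m,n}) = Σ_{j=0}^{n} binom(n, j) · C(K_{m−1, n−j}) + Σ_{i=1}^{m−1} Σ_{j=1}^{n} binom(m−1, i) · binom(n, j) · C(K_{m−1−i, n−j}), where C(K_{0,k}) = 1 for every k ≥ 0. -/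
/-- A composition of a graph `G` is a partition of its vertex set into (nonempty) blocks,
each of which induces a connected subgraph of `G`.  `numComp G` is the number of
compositions of `G`.  (In particular `C(K_{0,k}) = 1` since the edgeless graph's only
composition is the partition into singletons.) -/
noncomputable def numComp {V : Type*} [Fintype V] [DecidableEq V] (G : SimpleGraph V) : ℕ :=
  Nat.card {P : Finpartition (Finset.univ : Finset V) //
    ∀ b ∈ P.parts, (G.induce (b : Set V)).Connected}

/-- `numCompBip m n` is the number of compositions of the complete bipartite graph
`K_{m,n}`. -/
noncomputable def numCompBip (m n : ℕ) : ℕ :=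
  numComp (completeBipartiteGraph (Fin m) (Fin n))

namespace SimpleGraph

/-- The number of partitions of the vertex set `s` into blocks inducing connected subgraphs
of `G`. -/
noncomputable def numCompOn {V : Type*} [DecidableEq V] (G : SimpleGraph V) (s : Finset V) : ℕ :=
  Nat.card {P : Finpartition s // ∀ b ∈ P.parts, (G.induce (b : Set V)).Connected}

/-- Classify the compositions of `insert v s` by the block containing `v`. -/
theorem numCompOn_insert {V : Type*} [DecidableEq V] (G : SimpleGraph V)
    [DecidablePred fun t : Finset V ↦ (G.induce (t : Set V)).Connected] {v : V} {s : Finset V}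
    (hv : v ∉ s) :
    numCompOn G (insert v s) = ∑ t ∈ s.powerset,
      if (G.induce ((insert v t : Finset V) : Set V)).Connected then numCompOn G (s \ t)
      else 0 := by
  rw [← Finset.sum_filter, ← Finset.sum_coe_sort]
  simp only [numCompOn]
  rw [← Nat.card_sigma]
  symm
  have hprop (t : {t // t ∈ s.powerset.filter
      fun t ↦ (G.induce ((insert v t : Finset V) : Set V)).Connected}) :
      t.1 ⊆ s ∧ (G.induce ((insert v t.1 : Finset V) : Set V)).Connected := by
    rw [← Finset.mem_powerset]
    exact Finset.mem_filter.1 t.2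
  have hnot {t : Finset V} (Q : Finpartition (s \ t)) {b : Finset V} (hb : b ∈ Q.parts) :
      v ∉ b := fun h ↦ hv (Finset.sdiff_subset (Q.subset hb h))
  refine Nat.card_congr (Equiv.ofBijective (fun x ↦ ⟨x.2.1.extend (b := insert v x.1.1)
    (Finset.insert_ne_empty _ _) ?_ ?_, ?_⟩) ⟨?_, ?_⟩)
  · rw [Finset.disjoint_insert_right]
    exact ⟨fun h ↦ hv (Finset.sdiff_subset h), Finset.sdiff_disjoint⟩
  · rw [Finset.sup_eq_union, Finset.union_insert, Finset.sdiff_union_of_subset (hprop x.1).1]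
  · intro b hb
    obtain rfl | hb := Finset.mem_insert.1 hb
    · exact (hprop x.1).2
    · exact x.2.2 b hb
  · rintro ⟨t, Q⟩ ⟨t', Q'⟩ h
    have hparts : insert (insert v t.1) Q.1.parts = insert (insert v t'.1) Q'.1.parts :=
      congrArg (fun P ↦ P.1.parts) h
    have htt : insert v t.1 = insert v t'.1 := by
      have hmem : insert v t.1 ∈ insert (insert v t'.1) Q'.1.parts :=
        hparts ▸ Finset.mem_insert_self _ _
      exact (Finset.mem_insert.1 hmem).resolve_right
        fun hb ↦ hnot Q'.1 hb (Finset.mem_insert_self _ _)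
    have ht : t = t' := Subtype.ext <| by
      rw [← Finset.erase_insert (fun h ↦ hv ((hprop t).1 h)), htt,
        Finset.erase_insert (fun h ↦ hv ((hprop t').1 h))]
    subst ht
    have hQ : Q.1.parts = Q'.1.parts := by
      rw [← Finset.erase_insert (fun hb ↦ hnot Q.1 hb (Finset.mem_insert_self v t.1)), hparts,
        Finset.erase_insert (fun hb ↦ hnot Q'.1 hb (Finset.mem_insert_self v t.1))]
    rw [Subtype.ext (Finpartition.ext hQ)]
  · rintro ⟨P, hP⟩
    have hvs : v ∈ insert v s := Finset.mem_insert_self _ _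
    have hins : insert v ((P.part v).erase v) = P.part v :=
      Finset.insert_erase (P.mem_part hvs)
    have hsup : (P.parts.erase (P.part v)).sup id = s \ (P.part v).erase v := by
      ext x
      simp only [Finset.mem_sup, Finset.mem_erase, id, Finset.mem_sdiff, not_and]
      constructor
      · rintro ⟨b, ⟨hb, hbP⟩, hx⟩
        have hxv : x ∉ P.part v := fun h ↦ hb (P.eq_of_mem_parts hbP (P.part_mem.2 hvs) hx h)
        refine ⟨(Finset.mem_insert.1 (P.subset hbP hx)).resolve_left ?_, fun _ ↦ hxv⟩
        rintro rfl
        exact hxv (P.mem_part hvs)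
      · rintro ⟨hx, hxv⟩
        have hxs : x ∈ insert v s := Finset.mem_insert_of_mem hx
        refine ⟨P.part x, ⟨fun h ↦ ?_, P.part_mem.2 hxs⟩, P.mem_part hxs⟩
        exact hxv (by rintro rfl; exact hv hx) (h ▸ P.mem_part hxs)
    refine ⟨⟨⟨(P.part v).erase v, ?_⟩,
      ⟨P.ofSubset (Finset.erase_subset (P.part v) _) hsup,
        fun b hb ↦ hP b (Finset.mem_of_mem_erase hb)⟩⟩, ?_⟩
    · rw [Finset.mem_filter, Finset.mem_powerset, hins]
      exact ⟨Finset.subset_insert_iff.1 (P.part_subset v), hP _ (P.part_mem.2 hvs)⟩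
    · refine Subtype.ext (Finpartition.ext ?_)
      change insert (insert v ((P.part v).erase v)) (P.parts.erase (P.part v)) = P.parts
      rw [hins, Finset.insert_erase (P.part_mem.2 hvs)]

/-- The partition of `s.map e` obtained by applying the embedding `e` to every block. -/
def mapFinpartition {V W : Type*} [DecidableEq V] [DecidableEq W] (e : V ↪ W) {s : Finset V}
    (P : Finpartition s) : Finpartition (s.map e) :=
  Finpartition.ofExistsUnique (P.parts.map (Finset.mapEmbedding e).toEmbedding)
    (by
      intro p hp
      obtain ⟨b, hb, rfl⟩ := Finset.mem_map.1 hp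
      exact Finset.map_subset_map.2 (P.subset hb))
    (by
      intro a ha
      obtain ⟨x, hx, rfl⟩ := Finset.mem_map.1 ha
      obtain ⟨b, ⟨hb, hxb⟩, huniq⟩ := P.existsUnique_mem hx
      refine ⟨b.map e, ⟨Finset.mem_map_of_mem _ hb, Finset.mem_map_of_mem _ hxb⟩, ?_⟩
      rintro c ⟨hc, hxc⟩
      obtain ⟨c, hcP, rfl⟩ := Finset.mem_map.1 hc
      rw [← huniq c ⟨hcP, (Finset.mem_map' e).1 hxc⟩]
      rfl)
    (by
      intro h
      obtain ⟨b, hb, hb'⟩ := Finset.mem_map.1 h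
      exact P.ne_empty hb (Finset.map_eq_empty.1 hb'))

theorem mapFinpartition_bijective {V W : Type*} [DecidableEq V] [DecidableEq W] (e : V ↪ W)
    (s : Finset V) : Function.Bijective (mapFinpartition e (s := s)) := by
  constructor
  · intro P Q h
    exact Finpartition.ext (Finset.map_injective _ (congrArg Finpartition.parts h))
  · intro Q
    have hinj : Function.Injective (Finset.map e) := Finset.map_injective e
    refine ⟨Finpartition.ofExistsUnique (Q.parts.preimage (Finset.map e) hinj.injOn) ?_ ?_ ?_,
      Finpartition.ext ?_⟩
    · intro p hp
      exact Finset.map_subset_map.1 (Q.subset (Finset.mem_preimage.1 hp))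
    · intro a ha
      obtain ⟨b, ⟨hb, hab⟩, huniq⟩ := Q.existsUnique_mem (Finset.mem_map_of_mem e ha)
      obtain ⟨c, -, rfl⟩ := Finset.subset_map_iff.1 (Q.subset hb)
      refine ⟨c, ⟨Finset.mem_preimage.2 hb, (Finset.mem_map' e).1 hab⟩, ?_⟩
      rintro d ⟨hd, had⟩
      exact hinj (huniq _ ⟨Finset.mem_preimage.1 hd, Finset.mem_map_of_mem e had⟩)
    · intro h
      simp at h
    · ext b
      refine Finset.mem_map.trans ⟨?_, fun hb ↦ ?_⟩
      · rintro ⟨c, hc, rfl⟩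
        exact Finset.mem_preimage (hf := hinj.injOn).1 hc
      · obtain ⟨c, -, rfl⟩ := Finset.subset_map_iff.1 (Q.subset hb)
        exact ⟨c, Finset.mem_preimage (hf := hinj.injOn).2 hb, rfl⟩

theorem Embedding.connected_induce_map_iff {V W : Type*} {G : SimpleGraph V}
    {H : SimpleGraph W} (e : G ↪g H) (b : Finset V) :
    (H.induce (b.map e.toEmbedding : Set W)).Connected ↔ (G.induce (b : Set V)).Connected := by
  rw [Finset.coe_map]
  refine (Iso.connected_iff (⟨Equiv.Set.image e (b : Set V) e.injective, ?_⟩ :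
    G.induce (b : Set V) ≃g H.induce (e '' (b : Set V)))).symm
  intro x y
  exact e.map_adj_iff

theorem Embedding.numCompOn_map {V W : Type*} [DecidableEq V] [DecidableEq W]
    {G : SimpleGraph V} {H : SimpleGraph W} (e : G ↪g H) (s : Finset V) :
    numCompOn H (s.map e.toEmbedding) = numCompOn G s := by
  symm
  refine Nat.card_congr ((Equiv.ofBijective _
    (mapFinpartition_bijective e.toEmbedding s)).subtypeEquiv fun P ↦ ?_)
  change _ ↔ ∀ b ∈ P.parts.map _, _
  rw [Finset.forall_mem_map]
  exact forall₂_congr fun b _ ↦ (e.connected_induce_map_iff b).symm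

/-- An embedding of complete bipartite graphs induced by embeddings of the two parts. -/
def completeBipartiteGraphEmbedding {A B A' B' : Type*} (f : A ↪ A') (g : B ↪ B') :
    completeBipartiteGraph A B ↪g completeBipartiteGraph A' B' where
  toEmbedding := f.sumMap g
  map_rel_iff' {x y} := by cases x <;> cases y <;> simp [completeBipartiteGraph]

theorem numCompOn_completeBipartiteGraph {A B : Type*} [DecidableEq A] [DecidableEq B]
    (s : Finset A) (t : Finset B) :
    numCompOn (completeBipartiteGraph A B) (s.disjSum t) = numCompBip s.card t.card := by
  have hst : s.disjSum t = Finset.univ.map (completeBipartiteGraphEmbedding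
      (s.equivFin.symm.toEmbedding.trans (Function.Embedding.subtype _))
      (t.equivFin.symm.toEmbedding.trans (Function.Embedding.subtype _))).toEmbedding := by
    ext x
    rcases x with x | x
    · simp only [Finset.inl_mem_disjSum, Finset.mem_map, Finset.mem_univ, true_and]
      exact ⟨fun hx ↦ ⟨Sum.inl (s.equivFin ⟨x, hx⟩), by simp [completeBipartiteGraphEmbedding]⟩,
        by rintro ⟨y | y, hy⟩ <;> simp [completeBipartiteGraphEmbedding] at hy; simp [← hy]⟩
    · simp only [Finset.inr_mem_disjSum, Finset.mem_map, Finset.mem_univ, true_and]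
      exact ⟨fun hx ↦ ⟨Sum.inr (t.equivFin ⟨x, hx⟩), by simp [completeBipartiteGraphEmbedding]⟩,
        by rintro ⟨y | y, hy⟩ <;> simp [completeBipartiteGraphEmbedding] at hy; simp [← hy]⟩
  rw [hst, Embedding.numCompOn_map]
  rfl

theorem connected_induce_insert_inl_iff {A B : Type*} [DecidableEq A] [DecidableEq B] {a : A}
    {s : Finset A} (ha : a ∉ s) (t : Finset B) :
    ((completeBipartiteGraph A B).induce
      ((insert (Sum.inl a) (s.disjSum t) : Finset (A ⊕ B)) : Set (A ⊕ B))).Connected ↔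
      s = ∅ ∨ t ≠ ∅ := by
  constructor
  · intro h
    by_contra! hcon
    obtain ⟨hs, rfl⟩ := hcon
    obtain ⟨x, hx⟩ := hs
    have hne : (⟨Sum.inl a, by simp⟩ : ((insert (Sum.inl a) (s.disjSum ∅) :
        Finset (A ⊕ B)) : Set (A ⊕ B))) ≠ ⟨Sum.inl x, by simp [hx]⟩ := by
      intro h
      obtain rfl : a = x := by simpa using h
      exact ha hx
    have : Nontrivial _ := ⟨_, _, hne⟩
    obtain ⟨⟨y, hy⟩, hadj⟩ := h.preconnected.exists_adj_of_nontrivial ⟨Sum.inl a, by simp⟩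
    rcases y with y | y
    · simp [completeBipartiteGraph] at hadj
    · simp at hy
  · intro h
    have hright : ∀ y, ∀ hy : Sum.inr y ∈ ((insert (Sum.inl a) (s.disjSum t) :
        Finset (A ⊕ B)) : Set (A ⊕ B)), ((completeBipartiteGraph A B).induce
      ((insert (Sum.inl a) (s.disjSum t) : Finset (A ⊕ B)) : Set (A ⊕ B))).Reachable
        ⟨Sum.inl a, by simp⟩ ⟨Sum.inr y, hy⟩ := by
      intro y hy
      exact Adj.reachable (by simp [completeBipartiteGraph])
    refine connected_iff_exists_forall_reachable _ |>.2 ⟨⟨Sum.inl a, by simp⟩, ?_⟩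
    rintro ⟨y | y, hy⟩
    · obtain rfl | hy' : y = a ∨ y ∈ s := by simpa using hy
      · rfl
      · obtain ⟨z, hz⟩ := Finset.nonempty_iff_ne_empty.2
          (h.resolve_left (Finset.ne_empty_of_mem hy'))
        exact (hright z (by simp [hz])).trans (Adj.reachable (by simp [completeBipartiteGraph]))
    · exact hright y hy

end SimpleGraph

theorem numCompBip_succ (m n : ℕ) :
    numCompBip (m + 1) n = ∑ i ∈ Finset.range (m + 1), ∑ j ∈ Finset.range (n + 1),
      if i = 0 ∨ j ≠ 0 then m.choose i * n.choose j * numCompBip (m - i) (n - j) else 0 := by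
  classical
  set L : Finset (Fin (m + 1)) := Finset.univ.erase 0 with hL
  have hcard : L.card = m := by simp [hL]
  have huniv : (Finset.univ : Finset (Fin (m + 1) ⊕ Fin n)) =
      insert (Sum.inl 0) (L.disjSum Finset.univ) := by
    ext x
    rcases x with x | x <;> simp [hL, em]
  have hpow : (L.disjSum (Finset.univ : Finset (Fin n))).powerset =
      (L.powerset ×ˢ (Finset.univ : Finset (Fin n)).powerset).map
        Finset.sumEquiv.symm.toEquiv.toEmbedding := by
    ext t
    simp [Finset.mem_map_equiv, Finset.subset_disjSum]
  change SimpleGraph.numCompOn _ Finset.univ = _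
  rw [huniv, SimpleGraph.numCompOn_insert _ (by simp [hL]), hpow, Finset.sum_map,
    Finset.sum_product]
  have hterm : ∀ s ∈ L.powerset, ∀ t ∈ (Finset.univ : Finset (Fin n)).powerset,
      (if ((completeBipartiteGraph (Fin (m + 1)) (Fin n)).induce
        ((insert (Sum.inl 0) (s.disjSum t) : Finset _) : Set _)).Connected then
        SimpleGraph.numCompOn (completeBipartiteGraph (Fin (m + 1)) (Fin n))
          (L.disjSum Finset.univ \ s.disjSum t) else 0) =
      if s.card = 0 ∨ t.card ≠ 0 then numCompBip (m - s.card) (n - t.card) else 0 := by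
    intro s hs t ht
    rw [Finset.mem_powerset] at hs ht
    have hsdiff : L.disjSum Finset.univ \ s.disjSum t = (L \ s).disjSum (Finset.univ \ t) := by
      ext x
      rcases x with x | x <;> simp
    simp only [SimpleGraph.connected_induce_insert_inl_iff (a := (0 : Fin (m + 1)))
      (fun h ↦ by simpa [hL] using hs h) t]
    rw [hsdiff, SimpleGraph.numCompOn_completeBipartiteGraph, Finset.card_sdiff_of_subset hs,
      Finset.card_sdiff_of_subset ht, hcard, Finset.card_univ, Fintype.card_fin]
    simp only [Finset.card_eq_zero, ne_eq]
  refine (Finset.sum_congr rfl fun s hs ↦ Finset.sum_congr rfl fun t ht ↦ hterm s hs t ht).trans ?_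
  have hinner (i : ℕ) := Finset.sum_powerset_apply_card
    (fun j ↦ if i = 0 ∨ j ≠ 0 then numCompBip (m - i) (n - j) else 0)
    (x := (Finset.univ : Finset (Fin n)))
  simp only [Finset.card_univ, Fintype.card_fin] at hinner
  simp only [hinner]
  rw [Finset.sum_powerset_apply_card (fun i ↦ ∑ j ∈ Finset.range (n + 1),
    n.choose j • if i = 0 ∨ j ≠ 0 then numCompBip (m - i) (n - j) else 0), hcard]
  simp only [smul_eq_mul, mul_ite, mul_zero, Finset.mul_sum, mul_assoc]

/-- For `m ≥ 1` and `n ≥ 0`, the number of compositions of `K_{m,n}` satisfies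
`C(K_{m,n}) = Σ_{j=0}^{n} C(n,j)·C(K_{m−1,n−j})
  + Σ_{i=1}^{m−1} Σ_{j=1}^{n} C(m−1,i)·C(n,j)·C(K_{m−1−i,n−j})`. -/
theorem numCompBip_recurrence (m n : ℕ) (hm : 1 ≤ m) :
    numCompBip m n =
      (∑ j ∈ Finset.range (n + 1), n.choose j * numCompBip (m - 1) (n - j)) +
      ∑ i ∈ Finset.Icc 1 (m - 1), ∑ j ∈ Finset.Icc 1 n,
        (m - 1).choose i * n.choose j * numCompBip (m - 1 - i) (n - j) := by
  obtain ⟨m, rfl⟩ := Nat.exists_eq_add_of_le' hm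
  rw [Nat.add_sub_cancel, numCompBip_succ, Finset.range_eq_Ico,
    Finset.sum_eq_sum_Ico_succ_bot m.succ_pos]
  congr 1
  · simp
  · refine Finset.sum_congr (by ext; simp only [Finset.mem_Ico, Finset.mem_Icc]; omega) fun i hi ↦ ?_
    have hi0 : i ≠ 0 := by have := (Finset.mem_Icc.1 hi).1; omega
    rw [Finset.range_eq_Ico, Finset.sum_eq_sum_Ico_succ_bot n.succ_pos]
    simp only [hi0, false_or, ne_eq, not_true_eq_false, if_false, zero_add]
    refine Finset.sum_congr (by ext; simp only [Finset.mem_Ico, Finset.mem_Icc]; omega) fun j hj ↦ if_pos ?_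
    have := (Finset.mem_Icc.1 hj).1
    omega
end

section
/- Define an integer array (a_{m,i}) by: a_{m,0} = 0 for every m ≥ 0, a_{0,1} = 1, a_{0,i} = 0 for every i > 1, and for m ≥ 1, a_{m,i} = Σ_{r=0}^{m−1} binom(m−1, r) · a_{m−1−r, i−1} − Σ_{r=1}^{m−1} binom(m−1, r) · a_{m−1−r, i}. Then for all integers m ≥ 0 and n ≥ 0, the number of compositions of the complete bipartite graph K_{m,n} satisfies C(K_{m,n}) = Σ_{i=1}^{m+1} a_{m,i} · i^n. -/
open Finset

/-- The number of partitions of the finite set `s` all of whose blocks satisfy `p`. -/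
noncomputable def numPartitionsWith {V : Type*} [DecidableEq V] (p : Finset V → Prop)
    (s : Finset V) : ℕ :=
  Nat.card {P : Finpartition s // ∀ b ∈ P.parts, p b}

theorem numPartitionsWith_empty {V : Type*} [DecidableEq V] (p : Finset V → Prop) :
    numPartitionsWith p ∅ = 1 := by
  have hparts (P : Finpartition (∅ : Finset V)) : P.parts = ∅ :=
    P.parts_eq_empty_iff.2 rfl
  rw [numPartitionsWith, Nat.card_eq_one_iff_unique]
  refine ⟨⟨fun P Q => Subtype.ext (Finpartition.ext ?_)⟩, ⟨⟨Finpartition.empty _, ?_⟩⟩⟩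
  · rw [hparts, hparts]
  · intro b hb
    exact absurd hb (by rw [hparts]; simp)

/-- The partitions of `s` having `b` as a block correspond to the partitions of `s \ b`. -/
theorem card_filter_mem_parts {V : Type*} [DecidableEq V] (p : Finset V → Prop)
    [DecidablePred p] {s b : Finset V} (hbs : b ⊆ s) (hb : b.Nonempty) (hp : p b) :
    #{P : Finpartition s | (∀ c ∈ P.parts, p c) ∧ b ∈ P.parts} =
      #{Q : Finpartition (s \ b) | ∀ c ∈ Q.parts, p c} := by
  have hnot (Q : Finpartition (s \ b)) : b ∉ Q.parts := fun h => by
    obtain ⟨x, hx⟩ := hb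
    exact (mem_sdiff.1 (Q.le h hx)).2 hx
  symm
  refine card_bij
    (fun Q _ => Q.extend hb.ne_empty sdiff_disjoint (sdiff_union_of_subset hbs)) ?_ ?_ ?_
  · intro Q hQ
    simpa [Finpartition.extend, hp] using hQ
  · intro Q _ Q' _ h
    have h' := congrArg (fun P => P.parts.erase b) h
    simp only [Finpartition.extend, erase_insert (hnot _)] at h'
    exact Finpartition.ext h'
  · intro P hP
    simp only [mem_filter, mem_univ, true_and] at hP
    have hsup : (P.parts.erase b).sup id = s \ b := by
      ext y
      simp only [mem_sup, mem_erase, id, mem_sdiff]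
      constructor
      · rintro ⟨c, ⟨hcb, hc⟩, hy⟩
        exact ⟨P.le hc hy, fun hyb => hcb (P.eq_of_mem_parts hc hP.2 hy hyb)⟩
      · rintro ⟨hys, hyb⟩
        obtain ⟨c, hc, hy⟩ := P.exists_mem hys
        exact ⟨c, ⟨fun h => hyb (h ▸ hy), hc⟩, hy⟩
    refine ⟨P.ofSubset (erase_subset b P.parts) hsup, ?_, ?_⟩
    · simp only [mem_filter, mem_univ, true_and, Finpartition.ofSubset]
      exact fun c hc => hP.1 c (mem_of_mem_erase hc)
    · exact Finpartition.ext (insert_erase hP.2)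

/-- Classify partitions by the block containing a given element. -/
theorem numPartitionsWith_eq_sum {V : Type*} [DecidableEq V] (p : Finset V → Prop)
    [DecidablePred p] {s : Finset V} {x : V} (hx : x ∈ s) :
    numPartitionsWith p s =
      ∑ b ∈ s.powerset with x ∈ b ∧ p b, numPartitionsWith p (s \ b) := by
  have hcard (t : Finset V) : numPartitionsWith p t =
      #{P : Finpartition t | ∀ c ∈ P.parts, p c} := by
    rw [numPartitionsWith, Nat.card_eq_fintype_card, Fintype.card_subtype]
  rw [hcard, card_eq_sum_card_fiberwise (f := fun P => P.part x)
    (t := {b ∈ s.powerset | x ∈ b ∧ p b})]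
  · refine sum_congr rfl fun b hb => ?_
    simp only [mem_filter, mem_powerset] at hb
    rw [hcard, ← card_filter_mem_parts p hb.1 ⟨x, hb.2.1⟩ hb.2.2, filter_filter]
    congr 1
    refine filter_congr fun P _ => and_congr_right fun _ => ⟨?_, fun h => ?_⟩
    · rintro rfl
      exact P.part_mem.2 hx
    · exact P.part_eq_of_mem h hb.2.1
  · intro P hP
    simp only [coe_filter, mem_univ, true_and, Set.mem_ofPred_eq, mem_powerset] at hP ⊢
    exact ⟨P.part_subset x, P.mem_part_self.2 hx, hP _ (P.part_mem.2 hx)⟩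

theorem connected_induce_completeBipartiteGraph_iff {α β : Type*} (b : Finset (α ⊕ β)) :
    ((completeBipartiteGraph α β).induce (b : Set (α ⊕ β))).Connected ↔
      #b = 1 ∨ (b.toLeft.Nonempty ∧ b.toRight.Nonempty) := by
  constructor
  · intro h
    refine or_iff_not_imp_left.2 fun hb => ?_
    obtain ⟨z, hz⟩ := h.nonempty
    have hpos : 0 < #b := card_pos.2 ⟨z, hz⟩
    obtain ⟨x, hx, y, hy, hxy⟩ := one_lt_card.1 (show 1 < #b by omega)
    obtain ⟨w⟩ := h.preconnected ⟨x, hx⟩ ⟨y, hy⟩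
    cases w with
    | nil => exact absurd rfl hxy
    | @cons _ v _ hadj _ =>
      obtain ⟨v, hv⟩ := v
      rcases x with x | x <;> rcases v with v | v <;> simp at hadj
      · exact ⟨⟨x, mem_toLeft.2 hx⟩, ⟨v, mem_toRight.2 hv⟩⟩
      · exact ⟨⟨v, mem_toLeft.2 hv⟩, ⟨x, mem_toRight.2 hx⟩⟩
  · rintro (h | ⟨⟨u, hu⟩, ⟨v, hv⟩⟩)
    · obtain ⟨x, rfl⟩ := card_eq_one.1 h
      rw [SimpleGraph.connected_iff_exists_forall_reachable]
      refine ⟨⟨x, by simp⟩, ?_⟩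
      rintro ⟨y, hy⟩
      obtain rfl : y = x := by simpa using hy
      exact SimpleGraph.Reachable.refl _
    · rw [mem_toLeft] at hu
      rw [mem_toRight] at hv
      have huv : ((completeBipartiteGraph α β).induce (b : Set (α ⊕ β))).Reachable
          ⟨.inl u, hu⟩ ⟨.inr v, hv⟩ := SimpleGraph.Adj.reachable (by simp)
      rw [SimpleGraph.connected_iff_exists_forall_reachable]
      refine ⟨⟨.inl u, hu⟩, ?_⟩
      rintro ⟨y | y, hy⟩
      · exact huv.trans (SimpleGraph.Adj.reachable (by simp))
      · exact SimpleGraph.Adj.reachable (by simp)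

/-- Summing over the subsets of `s` containing `inl u` amounts to summing over pairs of subsets
of the two sides. -/
theorem sum_powerset_filter_inl_mem {α β M : Type*} [DecidableEq α] [DecidableEq β]
    [AddCommMonoid M] (s : Finset (α ⊕ β)) {u : α} (hu : .inl u ∈ s)
    (q : Finset (α ⊕ β) → Prop) [DecidablePred q] (f : Finset (α ⊕ β) → M) :
    ∑ b ∈ s.powerset with .inl u ∈ b ∧ q b, f b =
      ∑ A ∈ (s.toLeft.erase u).powerset, ∑ B ∈ s.toRight.powerset,
        if q ((insert u A).disjSum B) then f ((insert u A).disjSum B) else 0 := by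
  rw [← sum_product', ← sum_filter]
  symm
  refine sum_nbij' (fun x => (insert u x.1).disjSum x.2) (fun b => (b.toLeft.erase u, b.toRight))
    ?_ ?_ ?_ ?_ ?_
  · rintro ⟨A, B⟩ h
    simp only [mem_filter, mem_product, mem_powerset] at h ⊢
    refine ⟨disjSum_subset.2 ⟨insert_subset (mem_toLeft.2 hu) ?_, h.1.2⟩, by simp, h.2⟩
    exact h.1.1.trans (erase_subset _ _)
  · intro b h
    simp only [mem_filter, mem_product, mem_powerset] at h ⊢
    rw [insert_erase (mem_toLeft.2 h.2.1), toLeft_disjSum_toRight]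
    exact ⟨⟨erase_subset_erase _ (toLeft_subset_toLeft h.1), toRight_subset_toRight h.1⟩, h.2.2⟩
  · rintro ⟨A, B⟩ h
    simp only [mem_filter, mem_product, mem_powerset] at h
    have hA : u ∉ A := fun hA => by simpa using h.1.1 hA
    simp [erase_insert hA]
  · intro b h
    simp only [mem_filter, mem_powerset] at h
    simp only [insert_erase (mem_toLeft.2 h.2.1), toLeft_disjSum_toRight]
  · intros
    rfl

theorem numPartitionsWith_completeBipartiteGraph {α β : Type*} [DecidableEq α] [DecidableEq β]
    (R : ℕ → ℕ → ℤ) (hR0 : ∀ n, R 0 n = 1)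
    (hR : ∀ m n, R (m + 1) n =
      ∑ r ∈ range (m + 1), ∑ k ∈ range (n + 1),
          (m.choose r : ℤ) * ((n.choose k : ℤ) * R (m - r) (n - k)) -
        ∑ r ∈ range (m + 1), (m.choose r : ℤ) * R (m - r) n + R m n)
    (s : Finset (α ⊕ β)) :
    (numPartitionsWith (fun b : Finset (α ⊕ β) =>
      ((completeBipartiteGraph α β).induce (b : Set (α ⊕ β))).Connected) s : ℤ) =
      R #s.toLeft #s.toRight := by
  simp only [connected_induce_completeBipartiteGraph_iff]
  set p : Finset (α ⊕ β) → Prop :=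
    fun b => #b = 1 ∨ (b.toLeft.Nonempty ∧ b.toRight.Nonempty) with hp
  induction s using Finset.strongInduction with
  | H s ih =>
  have ih' {b : Finset (α ⊕ β)} {x : α ⊕ β} (hx : x ∈ s) (hb : x ∈ b) :
      (numPartitionsWith p (s \ b) : ℤ) = R #(s \ b).toLeft #(s \ b).toRight :=
    ih _ ⟨sdiff_subset, fun h => (mem_sdiff.1 (h hx)).2 hb⟩
  rcases s.toLeft.eq_empty_or_nonempty with hL | ⟨u, hu⟩
  · rcases s.eq_empty_or_nonempty with rfl | ⟨x, hx⟩
    · rw [numPartitionsWith_empty, hL, card_empty, hR0, Nat.cast_one]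
    · have hfilter : {b ∈ s.powerset | x ∈ b ∧ p b} = {{x}} := by
        ext b
        simp only [mem_filter, mem_powerset, mem_singleton, hp]
        constructor
        · rintro ⟨hbs, hxb, h | h⟩
          · obtain ⟨y, rfl⟩ := card_eq_one.1 h
            rw [mem_singleton.1 hxb]
          · exact absurd (h.1.mono (toLeft_subset_toLeft hbs)) (by simp [hL])
        · rintro rfl
          simpa using hx
      rw [numPartitionsWith_eq_sum p hx, hfilter, sum_singleton, ih' hx (mem_singleton_self x)]
      simp [toLeft_sdiff, hL, hR0]
  · have hus : .inl u ∈ s := mem_toLeft.1 hu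
    obtain ⟨m, hm⟩ : ∃ m, #s.toLeft = m + 1 :=
      ⟨_, (Nat.succ_pred_eq_of_pos (card_pos.2 ⟨u, hu⟩)).symm⟩
    have hm' : #(s.toLeft.erase u) = m := by rw [card_erase_of_mem hu, hm]; rfl
    rw [numPartitionsWith_eq_sum p hus, Nat.cast_sum, sum_powerset_filter_inl_mem s hus, hm, hR]
    have key : ∀ A ∈ (s.toLeft.erase u).powerset, ∀ B ∈ s.toRight.powerset,
        (if p ((insert u A).disjSum B) then
          (numPartitionsWith p (s \ (insert u A).disjSum B) : ℤ) else 0) =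
        R (m - #A) (#s.toRight - #B) - (if B = ∅ then R (m - #A) #s.toRight else 0) +
          if A = ∅ then (if B = ∅ then R m #s.toRight else 0) else 0 := by
      intro A hA B hB
      rw [mem_powerset] at hA hB
      have huA : u ∉ A := fun h => by simpa using hA h
      have hins : insert u A ⊆ s.toLeft := insert_subset hu (hA.trans (erase_subset _ _))
      have hval : (numPartitionsWith p (s \ (insert u A).disjSum B) : ℤ) =
          R (m - #A) (#s.toRight - #B) := by
        rw [ih' hus (by simp), toLeft_sdiff, toRight_sdiff, toLeft_disjSum, toRight_disjSum,
          card_sdiff_of_subset hins, card_sdiff_of_subset hB, card_insert_of_notMem huA, hm,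
          Nat.add_sub_add_right]
      have hpiff : p ((insert u A).disjSum B) ↔ (A = ∅ ∨ B ≠ ∅) := by
        simp only [hp, card_disjSum, card_insert_of_notMem huA, toLeft_disjSum, toRight_disjSum,
          ← nonempty_iff_ne_empty, ← card_eq_zero, ← card_pos]
        omega
      rw [hval, if_congr hpiff rfl rfl]
      by_cases hA : A = ∅ <;> by_cases hB : B = ∅ <;> simp [hA, hB]
    rw [sum_congr rfl fun A hA => sum_congr rfl (key A hA)]
    simp only [sum_add_distrib, sum_sub_distrib]
    congr 1
    · congr 1
      · have inner (j : ℕ) : ∑ B ∈ s.toRight.powerset, R (m - j) (#s.toRight - #B) =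
            ∑ k ∈ range (#s.toRight + 1), (#s.toRight).choose k • R (m - j) (#s.toRight - k) :=
          sum_powerset_apply_card fun k => R (m - j) (#s.toRight - k)
        simp only [inner]
        rw [sum_powerset_apply_card fun j => ∑ k ∈ range (#s.toRight + 1),
          (#s.toRight).choose k • R (m - j) (#s.toRight - k), hm']
        simp only [nsmul_eq_mul, mul_sum]
      · simp only [sum_ite_eq', empty_mem_powerset, if_true]
        rw [sum_powerset_apply_card fun j => R (m - j) #s.toRight, hm']
        simp only [nsmul_eq_mul]
    · rw [sum_eq_single_of_mem ∅ (empty_mem_powerset _) fun A _ hA => by simp [hA]]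
      simp

theorem sum_choose_mul_pow_sub (x : ℤ) (n : ℕ) :
    ∑ k ∈ range (n + 1), (n.choose k : ℤ) * x ^ (n - k) = (x + 1) ^ n := by
  rw [add_comm x 1, add_pow]
  exact sum_congr rfl fun k _ => by rw [one_pow, one_mul, mul_comm]


/-- Let `(a_{m,i})` be the integer array determined by `a_{m,0} = 0`, `a_{0,1} = 1`,
`a_{0,i} = 0` for `i > 1`, and for `m ≥ 1`, `i ≥ 1`,
`a_{m,i} = Σ_{r=0}^{m−1} C(m−1,r)·a_{m−1−r,i−1} − Σ_{r=1}^{m−1} C(m−1,r)·a_{m−1−r,i}`.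
Then `C(K_{m,n}) = Σ_{i=1}^{m+1} a_{m,i}·iⁿ` for all `m, n ≥ 0`. -/
theorem numCompBip_eq_sum_powers (a : ℕ → ℕ → ℤ)
    (h0 : ∀ m : ℕ, a m 0 = 0)
    (h01 : a 0 1 = 1)
    (h0i : ∀ i : ℕ, 1 < i → a 0 i = 0)
    (hrec : ∀ m : ℕ, 1 ≤ m → ∀ i : ℕ, 1 ≤ i →
      a m i = (∑ r ∈ Finset.range m, ((m - 1).choose r : ℤ) * a (m - 1 - r) (i - 1)) -
        ∑ r ∈ Finset.Icc 1 (m - 1), ((m - 1).choose r : ℤ) * a (m - 1 - r) i)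
    (m n : ℕ) :
    (numCompBip m n : ℤ) = ∑ i ∈ Finset.Icc 1 (m + 1), a m i * (i : ℤ) ^ n := by
  have hvan : ∀ m i, m + 1 < i → a m i = 0 := by
    intro m
    induction m using Nat.strong_induction_on with
    | _ m ih =>
      intro i hi
      rcases Nat.eq_zero_or_pos m with rfl | hm
      · exact h0i i (by omega)
      · rw [hrec m hm i (by omega), sum_eq_zero fun r hr => ?_, sum_eq_zero fun r hr => ?_,
          sub_zero]
        · rw [mem_Icc] at hr
          rw [ih _ (by omega) _ (by omega), mul_zero]
        · rw [mem_range] at hr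
          rw [ih _ (by omega) _ (by omega), mul_zero]
  set R : ℕ → ℕ → ℤ := fun m n => ∑ i ∈ Icc 1 (m + 1), a m i * (i : ℤ) ^ n with hRdef
  have hRrange (m n N : ℕ) (hN : m + 1 ≤ N) :
      ∑ i ∈ range (N + 1), a m i * (i : ℤ) ^ n = R m n := by
    symm
    refine sum_subset (fun i hi => ?_) fun i hi hi' => ?_
    · simp only [mem_Icc, mem_range] at hi ⊢
      omega
    · simp only [mem_Icc, mem_range] at hi hi'
      rcases Nat.eq_zero_or_pos i with rfl | hpos
      · rw [h0, zero_mul]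
      · rw [hvan m i (by omega), zero_mul]
  have hR0 (n : ℕ) : R 0 n = 1 := by simp [hRdef, h01]
  have hR (m n : ℕ) : R (m + 1) n =
      ∑ r ∈ range (m + 1), ∑ k ∈ range (n + 1),
          (m.choose r : ℤ) * ((n.choose k : ℤ) * R (m - r) (n - k)) -
        ∑ r ∈ range (m + 1), (m.choose r : ℤ) * R (m - r) n + R m n := by
    have hfirst (r : ℕ) : ∑ k ∈ range (n + 1),
        (m.choose r : ℤ) * ((n.choose k : ℤ) * R (m - r) (n - k)) =
        ∑ i ∈ range (m + 2), (m.choose r : ℤ) * a (m - r) i * ((i : ℤ) + 1) ^ n := by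
      simp only [← hRrange (m - r) _ (m + 1) (by omega), ← sum_choose_mul_pow_sub, mul_sum]
      rw [sum_comm]
      exact sum_congr rfl fun i _ => sum_congr rfl fun k _ => by ring
    have hsecond (r : ℕ) : (m.choose r : ℤ) * R (m - r) n =
        ∑ i ∈ range (m + 2), (m.choose r : ℤ) * a (m - r) (i + 1) * ((i : ℤ) + 1) ^ n := by
      rw [← hRrange (m - r) n (m + 2) (by omega), sum_range_succ', h0, zero_mul, add_zero, mul_sum]
      exact sum_congr rfl fun i _ => by push_cast; ring
    have hrec' (i : ℕ) : a (m + 1) (i + 1) =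
        ∑ r ∈ range (m + 1), (m.choose r : ℤ) * a (m - r) i -
          ∑ r ∈ Icc 1 m, (m.choose r : ℤ) * a (m - r) (i + 1) := by
      simpa using hrec (m + 1) (by omega) (i + 1) (by omega)
    have hIcc (f : ℕ → ℤ) : ∑ r ∈ range (m + 1), f r = ∑ r ∈ Icc 1 m, f r + f 0 := by
      rw [range_eq_Ico, sum_eq_sum_Ico_succ_bot (Nat.succ_pos m), add_comm]
      rfl
    rw [hIcc fun r => (m.choose r : ℤ) * R (m - r) n, Nat.choose_zero_right, Nat.cast_one, one_mul,
      Nat.sub_zero, ← sub_sub, sub_add_cancel, ← hRrange (m + 1) n (m + 2) le_rfl, sum_range_succ',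
      h0, zero_mul, add_zero]
    simp only [hfirst, hsecond, hrec']
    rw [sum_comm, sum_comm (s := Icc 1 m), ← sum_sub_distrib]
    refine sum_congr rfl fun i _ => ?_
    rw [← sum_mul, ← sum_mul, ← sub_mul, Nat.cast_succ]
  have h := numPartitionsWith_completeBipartiteGraph R hR0 hR
    (univ : Finset (Fin m ⊕ Fin n))
  have hl : #(univ : Finset (Fin m ⊕ Fin n)).toLeft = m := by simp
  have hr : #(univ : Finset (Fin m ⊕ Fin n)).toRight = n := by simp
  rw [hl, hr] at h
  exact h
end
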